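/- Let ψ : ℝ³ → ℝ be infinitely differentiable with zero mean over the unit sphere, i.e. ∫₀^{2π} ∫_{−π/2}^{π/2} Ψ(φ,θ) cos θ dθ dφ = 0 for its spherical-coordinate representation Ψ. Then ∫₀^{2π} ∫_{−π/2}^{π/2} (ΔΨ)² cos θ dθ dφ ≥ 2 ∫₀^{2π} ∫_{−π/2}^{π/2} [ (∂θΨ)² + (∂φΨ)²/cos²θ ] cos θ dθ dφ (the sharp Poincaré inequality: the squared L² norm of the vorticity is at least 2 times the squared L² norm of the velocity). -/

import Mathlib

open Real MeasureTheory

noncomputable section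

/-- The point of the unit sphere with longitude `φ` and latitude `θ`. -/
def sphPt (φ θ : ℝ) : ℝ × ℝ × ℝ :=
  (Real.cos φ * Real.cos θ, Real.sin φ * Real.cos θ, Real.sin θ)

/-- The spherical-coordinate representation of a function `ψ : ℝ³ → ℝ`. -/
def sphRep (ψ : ℝ × ℝ × ℝ → ℝ) (φ θ : ℝ) : ℝ := ψ (sphPt φ θ)

/-- The Laplace–Beltrami operator of the unit sphere in longitude-latitude coordinates:
`(ΔΨ)(φ,θ) = ∂θ²Ψ − tan θ · ∂θΨ + (1/cos²θ) · ∂φ²Ψ`. -/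
def LB (Ψ : ℝ → ℝ → ℝ) (φ θ : ℝ) : ℝ :=
  iteratedDeriv 2 (fun θ' => Ψ φ θ') θ
    - Real.tan θ * deriv (fun θ' => Ψ φ θ') θ
    + (1 / Real.cos θ ^ 2) * iteratedDeriv 2 (fun φ' => Ψ φ' θ) φ

/-- Partial derivative with respect to the longitude, the first variable. -/
def dLon (f : ℝ × ℝ → ℝ) (x : ℝ × ℝ) : ℝ := fderiv ℝ f x (1, 0)

/-- Partial derivative with respect to the latitude, the second variable. -/
def dLat (f : ℝ × ℝ → ℝ) (x : ℝ × ℝ) : ℝ := fderiv ℝ f x (0, 1)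

section PartialDerivatives

variable {f g : ℝ × ℝ → ℝ}

lemma contDiff_dLon (hf : ContDiff ℝ (⊤ : ℕ∞) f) : ContDiff ℝ (⊤ : ℕ∞) (dLon f) :=
  (hf.fderiv_right (m := (⊤ : ℕ∞)) (by simp)).clm_apply contDiff_const

lemma contDiff_dLat (hf : ContDiff ℝ (⊤ : ℕ∞) f) : ContDiff ℝ (⊤ : ℕ∞) (dLat f) :=
  (hf.fderiv_right (m := (⊤ : ℕ∞)) (by simp)).clm_apply contDiff_const

lemma contDiff_top_differentiable {E F : Type*} [NormedAddCommGroup E] [NormedSpace ℝ E]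
    [NormedAddCommGroup F] [NormedSpace ℝ F] {f : E → F} (hf : ContDiff ℝ (⊤ : ℕ∞) f) :
    Differentiable ℝ f :=
  hf.differentiable (by simp)

lemma dLon_dLat_comm (hf : ContDiff ℝ (⊤ : ℕ∞) f) : dLon (dLat f) = dLat (dLon f) := by
  funext x
  have hd : DifferentiableAt ℝ (fderiv ℝ f) x :=
    (contDiff_top_differentiable (hf.fderiv_right (m := (⊤ : ℕ∞)) (by simp))) x
  have hs : IsSymmSndFDerivAt ℝ f x :=
    hf.contDiffAt.isSymmSndFDerivAt (by
      rw [minSmoothness_of_isRCLikeNormedField]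
      exact WithTop.coe_le_coe.mpr (le_top : (2 : ℕ∞) ≤ ⊤))
  unfold dLon dLat
  rw [fderiv_clm_apply hd (differentiableAt_const _), fderiv_clm_apply hd (differentiableAt_const _)]
  simpa using hs (1, 0) (0, 1)

lemma dLon_mul (hf : ContDiff ℝ (⊤ : ℕ∞) f) (hg : ContDiff ℝ (⊤ : ℕ∞) g) (x : ℝ × ℝ) :
    dLon (fun y => f y * g y) x = dLon f x * g x + f x * dLon g x := by
  unfold dLon
  rw [fderiv_fun_mul (contDiff_top_differentiable hf x) (contDiff_top_differentiable hg x)]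
  simp; ring

lemma dLat_mul (hf : ContDiff ℝ (⊤ : ℕ∞) f) (hg : ContDiff ℝ (⊤ : ℕ∞) g) (x : ℝ × ℝ) :
    dLat (fun y => f y * g y) x = dLat f x * g x + f x * dLat g x := by
  unfold dLat
  rw [fderiv_fun_mul (contDiff_top_differentiable hf x) (contDiff_top_differentiable hg x)]
  simp; ring

lemma dLon_sub (hf : ContDiff ℝ (⊤ : ℕ∞) f) (hg : ContDiff ℝ (⊤ : ℕ∞) g) (x : ℝ × ℝ) :
    dLon (fun y => f y - g y) x = dLon f x - dLon g x := by
  unfold dLon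
  rw [fderiv_fun_sub (contDiff_top_differentiable hf x) (contDiff_top_differentiable hg x)]
  rfl

lemma dLat_sub (hf : ContDiff ℝ (⊤ : ℕ∞) f) (hg : ContDiff ℝ (⊤ : ℕ∞) g) (x : ℝ × ℝ) :
    dLat (fun y => f y - g y) x = dLat f x - dLat g x := by
  unfold dLat
  rw [fderiv_fun_sub (contDiff_top_differentiable hf x) (contDiff_top_differentiable hg x)]
  rfl

lemma hasDerivAt_lon {x : ℝ × ℝ} (hf : DifferentiableAt ℝ f x) :
    HasDerivAt (fun φ => f (φ, x.2)) (dLon f x) x.1 :=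
  hf.hasFDerivAt.comp_hasDerivAt x.1 ((hasDerivAt_id x.1).prodMk (hasDerivAt_const x.1 x.2))

lemma hasDerivAt_lat {x : ℝ × ℝ} (hf : DifferentiableAt ℝ f x) :
    HasDerivAt (fun θ => f (x.1, θ)) (dLat f x) x.2 :=
  hf.hasFDerivAt.comp_hasDerivAt x.2 ((hasDerivAt_const x.2 x.1).prodMk (hasDerivAt_id x.2))

lemma dLat_periodic {T : ℝ} (h : ∀ φ θ, f (φ + T, θ) = f (φ, θ)) (φ θ : ℝ) :
    dLat f (φ + T, θ) = dLat f (φ, θ) := by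
  have hper : (fun x : ℝ × ℝ => f (x + (T, 0))) = f := by
    funext ⟨a, b⟩
    simpa using h a b
  have := fderiv_comp_add_right (𝕜 := ℝ) (f := f) (x := (φ, θ)) (T, 0)
  rw [hper] at this
  simp [dLat, this]

end PartialDerivatives

lemma contDiff_cosLat : ContDiff ℝ (⊤ : ℕ∞) (fun x : ℝ × ℝ => cos x.2) := by fun_prop

lemma contDiff_sinLat : ContDiff ℝ (⊤ : ℕ∞) (fun x : ℝ × ℝ => sin x.2) := by fun_prop

lemma dLat_cosLat (x : ℝ × ℝ) : dLat (fun x : ℝ × ℝ => cos x.2) x = -sin x.2 :=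
  (hasDerivAt_lat (contDiff_top_differentiable contDiff_cosLat x)).unique (hasDerivAt_cos x.2)

lemma dLat_sinLat (x : ℝ × ℝ) : dLat (fun x : ℝ × ℝ => sin x.2) x = cos x.2 :=
  (hasDerivAt_lat (contDiff_top_differentiable contDiff_sinLat x)).unique (hasDerivAt_sin x.2)

/-- Divergence theorem for a vector field that is periodic in longitude and whose latitudinal
flux vanishes at the poles. -/
lemma integral_divergence_eq_zero {f g : ℝ × ℝ → ℝ} (hf : ContDiff ℝ (⊤ : ℕ∞) f)
    (hg : ContDiff ℝ (⊤ : ℕ∞) g) (hper : ∀ φ θ, f (φ + 2 * π, θ) = f (φ, θ))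
    (hpole : ∀ φ θ, cos θ = 0 → g (φ, θ) = 0) :
    (∫ φ in (0:ℝ)..(2*π), ∫ θ in (-(π/2))..(π/2), (dLon f (φ, θ) + dLat g (φ, θ))) = 0 := by
  have key := integral2_divergence_prod_of_hasFDerivAt f g (fderiv ℝ f) (fderiv ℝ g)
    0 (-(π/2)) (2*π) (π/2) hf.continuous.continuousOn hg.continuous.continuousOn
    (fun x _ => (contDiff_top_differentiable hf x).hasFDerivAt)
    (fun x _ => (contDiff_top_differentiable hg x).hasFDerivAt)
    (((contDiff_dLon hf).continuous.add (contDiff_dLat hg).continuous).continuousOn.integrableOn_compact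
      (isCompact_uIcc.prod isCompact_uIcc))
  refine key.trans ?_
  have h1 : ∀ φ, g (φ, π/2) = 0 := fun φ => hpole _ _ cos_pi_div_two
  have h2 : ∀ φ, g (φ, -(π/2)) = 0 := fun φ => hpole _ _ (by simp)
  have h3 : ∀ θ, f (2 * π, θ) = f (0, θ) := fun θ => by simpa using hper 0 θ
  simp [h1, h2, h3]

/-- The integrated Bochner inequality on the sphere. Here `q` and `p` are the latitudinal and
longitudinal components of a gradient in the orthonormal frame, and `dLat q`, `dLat p`, `r` are
the components of the Hessian. -/
lemma integral_bochner {p q r : ℝ × ℝ → ℝ} (hp : ContDiff ℝ (⊤ : ℕ∞) p)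
    (hq : ContDiff ℝ (⊤ : ℕ∞) q) (hr : ContDiff ℝ (⊤ : ℕ∞) r)
    (hpper : ∀ φ θ, p (φ + 2 * π, θ) = p (φ, θ)) (hqper : ∀ φ θ, q (φ + 2 * π, θ) = q (φ, θ))
    (hlonq : ∀ x, dLon q x = cos x.2 * dLat p x - sin x.2 * p x)
    (hlonp : ∀ x, dLon p x = cos x.2 * r x + sin x.2 * q x) :
    2 * (∫ φ in (0:ℝ)..(2*π), ∫ θ in (-(π/2))..(π/2),
        (q (φ, θ) ^ 2 + p (φ, θ) ^ 2) * cos θ)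
      ≤ ∫ φ in (0:ℝ)..(2*π), ∫ θ in (-(π/2))..(π/2),
        (dLat q (φ, θ) + r (φ, θ)) ^ 2 * cos θ := by
  have hp' := contDiff_dLat hp
  have hq' := contDiff_dLat hq
  have hc := contDiff_cosLat
  have hs := contDiff_sinLat
  let f : ℝ × ℝ → ℝ := fun x => dLat q x * p x - dLat p x * q x
  let g : ℝ × ℝ → ℝ := fun x => (dLon p x - sin x.2 * q x) * q x - cos x.2 * (dLat p x * p x)
  have hf : ContDiff ℝ (⊤ : ℕ∞) f := (hq'.mul hp).sub (hp'.mul hq)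
  have hg : ContDiff ℝ (⊤ : ℕ∞) g :=
    (((contDiff_dLon hp).sub (hs.mul hq)).mul hq).sub (hc.mul (hp'.mul hp))
  have hdiv : ∀ x, dLon f x + dLat g x =
      cos x.2 * (2 * dLat q x * r x - 2 * dLat p x ^ 2 - q x ^ 2 - p x ^ 2) := by
    intro x
    have e1 : dLon (dLat q) x = cos x.2 * dLat (dLat p) x - 2 * sin x.2 * dLat p x
        - cos x.2 * p x := by
      rw [dLon_dLat_comm hq, funext hlonq, dLat_sub (hc.mul hp') (hs.mul hp),
        dLat_mul hc hp', dLat_mul hs hp, dLat_cosLat, dLat_sinLat]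
      ring
    have e2 : dLon (dLat p) x = dLat (dLon p) x := by rw [dLon_dLat_comm hp]
    simp only [f, g]
    rw [dLon_sub (hq'.mul hp) (hp'.mul hq), dLon_mul hq' hp, dLon_mul hp' hq,
      dLat_sub (((contDiff_dLon hp).sub (hs.mul hq)).mul hq) (hc.mul (hp'.mul hp)),
      dLat_mul ((contDiff_dLon hp).sub (hs.mul hq)) hq, dLat_mul hc (hp'.mul hp),
      dLat_mul hp' hp, dLat_sub (contDiff_dLon hp) (hs.mul hq), dLat_mul hs hq,
      dLat_cosLat, dLat_sinLat, e1, e2, hlonq, hlonp]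
    ring
  have hzero := integral_divergence_eq_zero hf hg
    (fun φ θ => by simp only [f, dLat_periodic hqper, dLat_periodic hpper, hpper, hqper])
    (fun φ θ h => by simp [g, hlonp, h])
  have hcont : ∀ {F : ℝ × ℝ → ℝ}, Continuous F →
      Continuous (fun φ : ℝ => ∫ θ in (-(π/2))..(π/2), F (φ, θ)) := fun {F} hF =>
    intervalIntegral.continuous_parametric_intervalIntegral_of_continuous'
      (f := fun φ θ => F (φ, θ)) hF _ _
  have hslice : ∀ {F : ℝ × ℝ → ℝ}, Continuous F → ∀ φ : ℝ,
      IntervalIntegrable (fun θ => F (φ, θ)) volume (-(π/2)) (π/2) := fun hF φ =>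
    (hF.comp (by fun_prop : Continuous fun θ : ℝ => (φ, θ))).intervalIntegrable _ _
  let A : ℝ × ℝ → ℝ := fun x => (q x ^ 2 + p x ^ 2) * cos x.2
  let B : ℝ × ℝ → ℝ := fun x => (dLat q x + r x) ^ 2 * cos x.2
  let D : ℝ × ℝ → ℝ := fun x => dLon f x + dLat g x
  have hA : Continuous A := ((hq.pow 2).add (hp.pow 2)).mul hc |>.continuous
  have hB : Continuous B := ((hq'.add hr).pow 2).mul hc |>.continuous
  have hD : Continuous D := ((contDiff_dLon hf).add (contDiff_dLat hg)).continuous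
  have hpi := pi_pos
  have hle : (∫ φ in (0:ℝ)..(2*π), ∫ θ in (-(π/2))..(π/2), (2 * A (φ, θ) + 2 * D (φ, θ)))
      ≤ ∫ φ in (0:ℝ)..(2*π), ∫ θ in (-(π/2))..(π/2), B (φ, θ) := by
    have hAD : Continuous (fun x => 2 * A x + 2 * D x) := by fun_prop
    refine intervalIntegral.integral_mono_on (by positivity)
      ((hcont hAD).intervalIntegrable _ _) ((hcont hB).intervalIntegrable _ _) fun φ _ => ?_
    refine intervalIntegral.integral_mono_on (by linarith) (hslice hAD φ) (hslice hB φ)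
      fun θ hθ => ?_
    have hcos : 0 ≤ cos θ := cos_nonneg_of_mem_Icc hθ
    have := mul_nonneg hcos (add_nonneg (sq_nonneg (dLat q (φ, θ) - r (φ, θ)))
      (mul_nonneg zero_le_four (sq_nonneg (dLat p (φ, θ)))))
    simp only [A, B, D, hdiv]
    nlinarith
  have hsplit : (∫ φ in (0:ℝ)..(2*π), ∫ θ in (-(π/2))..(π/2), (2 * A (φ, θ) + 2 * D (φ, θ)))
      = 2 * (∫ φ in (0:ℝ)..(2*π), ∫ θ in (-(π/2))..(π/2), A (φ, θ))
        + 2 * ∫ φ in (0:ℝ)..(2*π), ∫ θ in (-(π/2))..(π/2), D (φ, θ) := by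
    have : ∀ φ, (∫ θ in (-(π/2))..(π/2), (2 * A (φ, θ) + 2 * D (φ, θ)))
        = 2 * (∫ θ in (-(π/2))..(π/2), A (φ, θ)) + 2 * ∫ θ in (-(π/2))..(π/2), D (φ, θ) := by
      intro φ
      rw [intervalIntegral.integral_add ((hslice hA φ).const_mul 2) ((hslice hD φ).const_mul 2),
        intervalIntegral.integral_const_mul, intervalIntegral.integral_const_mul]
    simp only [this]
    rw [intervalIntegral.integral_add (((hcont hA).intervalIntegrable _ _).const_mul 2)
        (((hcont hD).intervalIntegrable _ _).const_mul 2),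
      intervalIntegral.integral_const_mul, intervalIntegral.integral_const_mul]
  rw [hsplit, hzero, mul_zero, add_zero] at hle
  exact hle

section Sphere

/-- The unit tangent vector pointing north at longitude `x.1` and latitude `x.2`. -/
def northVec (x : ℝ × ℝ) : ℝ × ℝ × ℝ :=
  (-(cos x.1 * sin x.2), -(sin x.1 * sin x.2), cos x.2)

/-- The unit tangent vector pointing east at longitude `x.1` and latitude `x.2`. -/
def eastVec (x : ℝ × ℝ) : ℝ × ℝ × ℝ := (-sin x.1, cos x.1, 0)

variable {ψ : ℝ × ℝ × ℝ → ℝ}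

lemma contDiff_sphPt : ContDiff ℝ (⊤ : ℕ∞) (fun x : ℝ × ℝ => sphPt x.1 x.2) := by
  unfold sphPt; fun_prop

lemma contDiff_northVec : ContDiff ℝ (⊤ : ℕ∞) northVec := by
  unfold northVec; fun_prop

lemma contDiff_eastVec : ContDiff ℝ (⊤ : ℕ∞) eastVec := by
  unfold eastVec; fun_prop

lemma hasDerivAt_sphPt_lon (φ θ : ℝ) :
    HasDerivAt (fun φ' => sphPt φ' θ) (cos θ • eastVec (φ, θ)) φ := by
  have := ((hasDerivAt_cos φ).mul_const (cos θ)).prodMk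
    (((hasDerivAt_sin φ).mul_const (cos θ)).prodMk (hasDerivAt_const φ (sin θ)))
  convert! this using 1
  simp [eastVec, mul_comm]

lemma hasDerivAt_sphPt_lat (φ θ : ℝ) :
    HasDerivAt (fun θ' => sphPt φ θ') (northVec (φ, θ)) θ := by
  have := ((hasDerivAt_cos θ).const_mul (cos φ)).prodMk
    (((hasDerivAt_cos θ).const_mul (sin φ)).prodMk (hasDerivAt_sin θ))
  convert! this using 1
  simp [northVec]

lemma hasDerivAt_eastVec_lon (φ θ : ℝ) :
    HasDerivAt (fun φ' => eastVec (φ', θ))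
      (sin θ • northVec (φ, θ) - cos θ • sphPt φ θ) φ := by
  have := (hasDerivAt_sin φ).neg.prodMk ((hasDerivAt_cos φ).prodMk (hasDerivAt_const φ (0 : ℝ)))
  convert! this using 1
  have h := sin_sq_add_cos_sq θ
  simp only [northVec, sphPt, Prod.smul_mk, smul_eq_mul, Prod.mk_sub_mk, Prod.mk.injEq]
  refine ⟨?_, ?_, ?_⟩
  · linear_combination (-cos φ) * h
  · linear_combination (-sin φ) * h
  · ring

/-- The northward component of the gradient of `ψ` restricted to the sphere. -/
def gradNorth (ψ : ℝ × ℝ × ℝ → ℝ) (x : ℝ × ℝ) : ℝ :=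
  fderiv ℝ ψ (sphPt x.1 x.2) (northVec x)

/-- The eastward component of the gradient of `ψ` restricted to the sphere. -/
def gradEast (ψ : ℝ × ℝ × ℝ → ℝ) (x : ℝ × ℝ) : ℝ :=
  fderiv ℝ ψ (sphPt x.1 x.2) (eastVec x)

/-- The east-east component of the covariant Hessian of `ψ` restricted to the sphere. -/
def hessEast (ψ : ℝ × ℝ × ℝ → ℝ) (x : ℝ × ℝ) : ℝ :=
  fderiv ℝ (fderiv ℝ ψ) (sphPt x.1 x.2) (eastVec x) (eastVec x)
    - fderiv ℝ ψ (sphPt x.1 x.2) (sphPt x.1 x.2)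

lemma contDiff_fderiv_sphPt (hψ : ContDiff ℝ (⊤ : ℕ∞) ψ) :
    ContDiff ℝ (⊤ : ℕ∞) (fun x : ℝ × ℝ => fderiv ℝ ψ (sphPt x.1 x.2)) :=
  (hψ.fderiv_right (m := (⊤ : ℕ∞)) (by simp)).comp contDiff_sphPt

lemma contDiff_gradNorth (hψ : ContDiff ℝ (⊤ : ℕ∞) ψ) :
    ContDiff ℝ (⊤ : ℕ∞) (gradNorth ψ) :=
  (contDiff_fderiv_sphPt hψ).clm_apply contDiff_northVec

lemma contDiff_gradEast (hψ : ContDiff ℝ (⊤ : ℕ∞) ψ) :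
    ContDiff ℝ (⊤ : ℕ∞) (gradEast ψ) :=
  (contDiff_fderiv_sphPt hψ).clm_apply contDiff_eastVec

lemma contDiff_hessEast (hψ : ContDiff ℝ (⊤ : ℕ∞) ψ) :
    ContDiff ℝ (⊤ : ℕ∞) (hessEast ψ) := by
  have h2 : ContDiff ℝ (⊤ : ℕ∞) (fderiv ℝ (fderiv ℝ ψ)) :=
    (hψ.fderiv_right (m := (⊤ : ℕ∞)) (by simp)).fderiv_right (by simp)
  exact (((h2.comp contDiff_sphPt).clm_apply contDiff_eastVec).clm_apply contDiff_eastVec).sub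
    ((contDiff_fderiv_sphPt hψ).clm_apply contDiff_sphPt)

lemma hasDerivAt_sphRep_lon (hψ : Differentiable ℝ ψ) (φ θ : ℝ) :
    HasDerivAt (fun φ' => sphRep ψ φ' θ) (cos θ * gradEast ψ (φ, θ)) φ := by
  have := (hψ (sphPt φ θ)).hasFDerivAt.comp_hasDerivAt φ (hasDerivAt_sphPt_lon φ θ)
  simpa [gradEast] using! this

lemma hasDerivAt_sphRep_lat (hψ : Differentiable ℝ ψ) (φ θ : ℝ) :
    HasDerivAt (fun θ' => sphRep ψ φ θ') (gradNorth ψ (φ, θ)) θ :=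
  (hψ (sphPt φ θ)).hasFDerivAt.comp_hasDerivAt θ (hasDerivAt_sphPt_lat φ θ)

lemma dLon_gradEast (hψ : ContDiff ℝ (⊤ : ℕ∞) ψ) (x : ℝ × ℝ) :
    dLon (gradEast ψ) x = cos x.2 * hessEast ψ x + sin x.2 * gradNorth ψ x := by
  have hd : Differentiable ℝ (fderiv ℝ ψ) :=
    contDiff_top_differentiable (hψ.fderiv_right (m := (⊤ : ℕ∞)) (by simp))
  have h1 := (hd (sphPt x.1 x.2)).hasFDerivAt.comp_hasDerivAt x.1 (hasDerivAt_sphPt_lon x.1 x.2)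
  have h2 := h1.clm_apply (hasDerivAt_eastVec_lon x.1 x.2)
  have h3 := hasDerivAt_lon (contDiff_top_differentiable (contDiff_gradEast hψ) x)
  refine (h3.unique h2).trans ?_
  simp [hessEast, gradNorth]
  ring

lemma dLon_gradNorth (hψ : ContDiff ℝ (⊤ : ℕ∞) ψ) (x : ℝ × ℝ) :
    dLon (gradNorth ψ) x = cos x.2 * dLat (gradEast ψ) x - sin x.2 * gradEast ψ x := by
  have hu : ContDiff ℝ (⊤ : ℕ∞) (fun x : ℝ × ℝ => sphRep ψ x.1 x.2) := hψ.comp contDiff_sphPt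
  have hψ' := contDiff_top_differentiable hψ
  have hlat : dLat (fun x : ℝ × ℝ => sphRep ψ x.1 x.2) = gradNorth ψ := funext fun y =>
    (hasDerivAt_lat (contDiff_top_differentiable hu y)).unique (hasDerivAt_sphRep_lat hψ' y.1 y.2)
  have hlon : dLon (fun x : ℝ × ℝ => sphRep ψ x.1 x.2) = fun y => cos y.2 * gradEast ψ y :=
    funext fun y =>
      (hasDerivAt_lon (contDiff_top_differentiable hu y)).unique
        (hasDerivAt_sphRep_lon hψ' y.1 y.2)
  rw [← hlat, dLon_dLat_comm hu, hlon, dLat_mul contDiff_cosLat (contDiff_gradEast hψ),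
    dLat_cosLat]
  ring

lemma LB_sphRep (hψ : ContDiff ℝ (⊤ : ℕ∞) ψ) (φ : ℝ) {θ : ℝ} (hθ : cos θ ≠ 0) :
    LB (sphRep ψ) φ θ = dLat (gradNorth ψ) (φ, θ) + hessEast ψ (φ, θ) := by
  have hψ' := contDiff_top_differentiable hψ
  have hlat : deriv (fun θ' => sphRep ψ φ θ') = fun θ' => gradNorth ψ (φ, θ') :=
    funext fun θ' => (hasDerivAt_sphRep_lat hψ' φ θ').deriv
  have hlon : deriv (fun φ' => sphRep ψ φ' θ) = fun φ' => cos θ * gradEast ψ (φ', θ) :=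
    funext fun φ' => (hasDerivAt_sphRep_lon hψ' φ' θ).deriv
  have h2lat := hasDerivAt_lat (contDiff_top_differentiable (contDiff_gradNorth hψ) (φ, θ))
  have h2lon := (hasDerivAt_lon
    (contDiff_top_differentiable (contDiff_gradEast hψ) (φ, θ))).const_mul (cos θ)
  simp only [LB, iteratedDeriv_succ, iteratedDeriv_zero, hlat, hlon, tan_eq_sin_div_cos]
  rw [h2lat.deriv, h2lon.deriv, dLon_gradEast hψ]
  field_simp
  ring

lemma sphPt_periodic (φ θ : ℝ) : sphPt (φ + 2 * π) θ = sphPt φ θ := by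
  simp [sphPt]

end Sphere

/-- Sharp Poincaré inequality on the sphere: for a smooth function of zero mean, the squared
`L²` norm of the vorticity `ΔΨ` is at least `2` times the squared `L²` norm of the velocity. -/
theorem poincare_sphere_first (ψ : ℝ × ℝ × ℝ → ℝ)
    (hψ : ContDiff ℝ (⊤ : ℕ∞) ψ)
    (hmean : (∫ φ in (0:ℝ)..(2*π), ∫ θ in (-(π/2))..(π/2),
        sphRep ψ φ θ * Real.cos θ) = 0) :
    (∫ φ in (0:ℝ)..(2*π), ∫ θ in (-(π/2))..(π/2),
        (LB (sphRep ψ) φ θ) ^ 2 * Real.cos θ)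
      ≥ 2 * ∫ φ in (0:ℝ)..(2*π), ∫ θ in (-(π/2))..(π/2),
          ((deriv (fun θ' => sphRep ψ φ θ') θ) ^ 2
            + (deriv (fun φ' => sphRep ψ φ' θ) φ) ^ 2 / Real.cos θ ^ 2) * Real.cos θ := by
  have hψ' := contDiff_top_differentiable hψ
  have hcos : ∀ θ ∈ Set.Ioo (-(π/2)) (π/2), cos θ ≠ 0 := fun θ hθ => (cos_pos_of_mem_Ioo hθ).ne'
  have hpi : -(π/2) ≤ π/2 := by linarith [pi_pos]
  have key := integral_bochner (contDiff_gradEast hψ) (contDiff_gradNorth hψ)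
    (contDiff_hessEast hψ)
    (fun φ θ => by simp [gradEast, sphPt_periodic, eastVec])
    (fun φ θ => by simp [gradNorth, sphPt_periodic, northVec])
    (dLon_gradNorth hψ) (dLon_gradEast hψ)
  refine ge_iff_le.mpr (le_of_eq_of_le ?_ (key.trans_eq ?_))
  · congr 1
    refine intervalIntegral.integral_congr fun φ _ => ?_
    refine intervalIntegral.integral_congr_Ioo_of_le hpi fun θ hθ => ?_
    have hθ' := hcos θ hθ
    simp only [(hasDerivAt_sphRep_lat hψ' φ θ).deriv, (hasDerivAt_sphRep_lon hψ' φ θ).deriv]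
    field_simp
  · refine intervalIntegral.integral_congr fun φ _ => ?_
    refine intervalIntegral.integral_congr_Ioo_of_le hpi fun θ hθ => ?_
    simp only [LB_sphRep hψ φ (hcos θ hθ)]
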